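/- (MMSE ordering lemma.) Let X be a Gaussian random vector in R^p and U an arbitrary random vector. Let N_1 ~ N(0,Σ_1) and N_2 ~ N(0,Σ_2) be independent of (X,U), with Σ_2 ≻ Σ_1 ≻ 0. Then Cov(X | X+N_1, U)^{-1} − Σ_1^{-1} ⪰ Cov(X | X+N_2, U)^{-1} − Σ_2^{-1}. -/

import Mathlib

open MeasureTheory ProbabilityTheory

noncomputable def crossCov {Ω : Type*} [MeasurableSpace Ω] (μ : Measure Ω) {p : ℕ}
    (X Y : Ω → Fin p → ℝ) : Matrix (Fin p) (Fin p) ℝ :=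
  Matrix.of fun i j =>
    ∫ ω, (X ω i - ∫ ω', X ω' i ∂μ) * (Y ω j - ∫ ω', Y ω' j ∂μ) ∂μ

/-- A random vector is (jointly) Gaussian if every linear functional of it is Gaussian. -/
def IsGaussianVec {Ω : Type*} [MeasurableSpace Ω] (μ : Measure Ω) {ι : Type*} [Fintype ι]
    (X : Ω → ι → ℝ) : Prop :=
  ∀ a : ι → ℝ, ∃ m : ℝ, ∃ v : NNReal,
    Measure.map (fun ω => ∑ i, a i * X ω i) μ = gaussianReal m v

/-- Conditional (MMSE) error covariance of `X` given the σ-algebra `m`. -/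
noncomputable def condCovGiven {Ω : Type*} [m0 : MeasurableSpace Ω] (μ : Measure Ω) {p : ℕ}
    (X : Ω → Fin p → ℝ) (m : MeasurableSpace Ω) : Matrix (Fin p) (Fin p) ℝ :=
  Matrix.of fun i j =>
    ∫ ω, (X ω i - (μ[fun ω' => X ω' i | m]) ω) * (X ω j - (μ[fun ω' => X ω' j | m]) ω) ∂μ


section MatrixOrder

open Matrix

lemma Matrix.PosDef.inv_sub_inv_posSemidef {n : Type*} [Fintype n] [DecidableEq n]
    {A B : Matrix n n ℝ} (hA : A.PosDef) (hB : B.PosDef) (h : (B - A).PosSemidef) :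
    (A⁻¹ - B⁻¹).PosSemidef := by
  have := hB.isUnit.invertible
  have := hA.inv.isUnit.invertible
  have h₁ : (fromBlocks B 1 1ᴴ A⁻¹).PosSemidef := by
    rw [PosDef.fromBlocks₂₂ B 1 hA.inv]
    simpa [nonsing_inv_nonsing_inv A ((isUnit_iff_isUnit_det A).1 hA.isUnit)] using h
  rw [PosDef.fromBlocks₁₁ 1 A⁻¹ hB] at h₁
  simpa using h₁

/-- If `u ↦ u ⬝ᵥ (Sᵢ - Mᵢ) *ᵥ u` satisfies the quadratic inequality coming from the
superposition of two independent noises, then `M₁⁻¹ - S₁⁻¹ ⪰ M₂⁻¹ - S₂⁻¹`. -/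
lemma posSemidef_inv_sub_inv_sub {n : Type*} [Fintype n] [DecidableEq n]
    {M₁ M₂ S₁ S₂ : Matrix n n ℝ} (hM₁ : M₁.PosDef) (hM₂ : M₂.PosDef) (hS₁ : S₁.PosDef)
    (hS₂ : S₂.PosDef) (hSM : (S₁ - M₁).PosSemidef)
    (h : ∀ s t w : n → ℝ, S₂ *ᵥ w = S₁ *ᵥ s + (S₂ - S₁) *ᵥ t →
      w ⬝ᵥ (S₂ - M₂) *ᵥ w ≤ s ⬝ᵥ (S₁ - M₁) *ᵥ s + t ⬝ᵥ (S₂ - S₁) *ᵥ t) :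
    ((M₁⁻¹ - S₁⁻¹) - (M₂⁻¹ - S₂⁻¹)).PosSemidef := by
  set G := M₁⁻¹ - S₁⁻¹ + S₂⁻¹ with hGdef
  have hK : (M₁⁻¹ - S₁⁻¹).PosSemidef := hM₁.inv_sub_inv_posSemidef hS₁ hSM
  have hG : G.PosDef := PosDef.posSemidef_add hK hS₂.inv
  have hdet {A : Matrix n n ℝ} (hA : A.PosDef) : IsUnit A.det :=
    (isUnit_iff_isUnit_det A).1 hA.isUnit
  have hT {A : Matrix n n ℝ} (hA : A.IsHermitian) : Aᵀ = A := by
    rw [← conjTranspose_eq_transpose_of_trivial]; exact hA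
  have e₁ : M₁⁻¹ * M₁ = 1 := nonsing_inv_mul _ (hdet hM₁)
  have e₂ : S₁⁻¹ * S₁ = 1 := nonsing_inv_mul _ (hdet hS₁)
  have e₃ : S₂⁻¹ * S₂ = 1 := nonsing_inv_mul _ (hdet hS₂)
  have e₄ : S₁ * S₁⁻¹ = 1 := mul_nonsing_inv _ (hdet hS₁)
  have e₅ : S₂ * S₂⁻¹ = 1 := mul_nonsing_inv _ (hdet hS₂)
  have e₆ : G⁻¹ * G = 1 := nonsing_inv_mul _ (hdet hG)
  have e₇ : G * G⁻¹ = 1 := mul_nonsing_inv _ (hdet hG)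
  have key : (G * M₂ * G - G).PosSemidef := by
    have hid : G * M₂ * G - G = M₁⁻¹ * (S₁ - M₁) * M₁⁻¹
        + (M₁⁻¹ - S₁⁻¹) * (S₂ - S₁) * (M₁⁻¹ - S₁⁻¹) - G * (S₂ - M₂) * G := by
      have h₁ : G * S₂ * G = (M₁⁻¹ - S₁⁻¹) * S₂ * (M₁⁻¹ - S₁⁻¹)
          + (M₁⁻¹ - S₁⁻¹) + (M₁⁻¹ - S₁⁻¹) + S₂⁻¹ := by
        rw [hGdef]
        generalize M₁⁻¹ - S₁⁻¹ = K
        calc _ = K * S₂ * K + K * (S₂ * S₂⁻¹) + (S₂⁻¹ * S₂) * K + S₂⁻¹ * S₂ * S₂⁻¹ := by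
              noncomm_ring
          _ = _ := by rw [e₃, e₅]; noncomm_ring
      have h₂ : (M₁⁻¹ - S₁⁻¹) * S₁ * (M₁⁻¹ - S₁⁻¹)
          = M₁⁻¹ * S₁ * M₁⁻¹ - M₁⁻¹ - M₁⁻¹ + S₁⁻¹ := by
        calc _ = M₁⁻¹ * S₁ * M₁⁻¹ - M₁⁻¹ * (S₁ * S₁⁻¹) - (S₁⁻¹ * S₁) * M₁⁻¹
              + (S₁⁻¹ * S₁) * S₁⁻¹ := by noncomm_ring
          _ = _ := by rw [e₂, e₄]; noncomm_ring
      have h₃ : M₁⁻¹ * (S₁ - M₁) * M₁⁻¹ = M₁⁻¹ * S₁ * M₁⁻¹ - M₁⁻¹ := by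
        calc _ = M₁⁻¹ * S₁ * M₁⁻¹ - (M₁⁻¹ * M₁) * M₁⁻¹ := by noncomm_ring
          _ = _ := by rw [e₁]; noncomm_ring
      rw [h₃, mul_sub G, sub_mul _ _ G, h₁, mul_sub _ S₂, sub_mul _ _ (M₁⁻¹ - S₁⁻¹), h₂, hGdef]
      abel
    refine PosSemidef.of_dotProduct_mulVec_nonneg ?_ fun x ↦ ?_
    · refine IsHermitian.sub ?_ hG.1
      have := isHermitian_conjTranspose_mul_mul G hM₂.1
      rwa [hG.1.eq] at this
    · have hx := h (M₁⁻¹ *ᵥ x) ((M₁⁻¹ - S₁⁻¹) *ᵥ x) (G *ᵥ x) (by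
        simp only [mulVec_mulVec, ← add_mulVec]
        congr 1
        rw [hGdef]
        calc _ = S₂ * M₁⁻¹ - S₂ * S₁⁻¹ + S₂ * S₂⁻¹ := by noncomm_ring
          _ = S₂ * M₁⁻¹ - S₂ * S₁⁻¹ + S₁ * S₁⁻¹ := by rw [e₄, e₅]
          _ = _ := by noncomm_ring)
      have hq (A B : Matrix n n ℝ) (hA : A.IsHermitian) :
          (A *ᵥ x) ⬝ᵥ B *ᵥ (A *ᵥ x) = x ⬝ᵥ (A * B * A) *ᵥ x := by
        nth_rw 1 [← hT hA]
        rw [mulVec_transpose, ← dotProduct_mulVec, mulVec_mulVec, mulVec_mulVec, mul_assoc]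
      rw [hq _ _ hG.1, hq _ _ hM₁.inv.1, hq _ _ hK.1] at hx
      rw [hid, sub_mulVec, add_mulVec, dotProduct_sub, dotProduct_add, star_trivial]
      linarith
  have key' : (M₂ - G⁻¹).PosSemidef := by
    have := key.conjTranspose_mul_mul_same G⁻¹
    rw [hG.inv.1.eq] at this
    convert this using 1
    calc M₂ - G⁻¹ = (G⁻¹ * G) * M₂ * (G * G⁻¹) - (G⁻¹ * G) * G⁻¹ := by rw [e₆, e₇]; noncomm_ring
      _ = _ := by noncomm_ring
  have := hG.inv.inv_sub_inv_posSemidef hM₂ key'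
  rw [nonsing_inv_nonsing_inv G (hdet hG)] at this
  convert this using 1
  rw [hGdef]; abel

end MatrixOrder

section CondExp

variable {Ω : Type*} {m m₁ m₂ mV mZ : MeasurableSpace Ω} [m0 : MeasurableSpace Ω] {μ : Measure Ω}

lemma condExp_comp_of_map {β γ : Type*} [MeasurableSpace β] [mγ : MeasurableSpace γ]
    [IsFiniteMeasure μ] {Φ : Ω → β} (hΦ : Measurable Φ) {F : β → ℝ} {G : β → γ}
    (hG : Measurable G) (hF : Integrable F (μ.map Φ)) :
    μ[fun ω ↦ F (Φ ω) | mγ.comap (fun ω ↦ G (Φ ω))] =ᵐ[μ]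
      fun ω ↦ ((μ.map Φ)[F | mγ.comap G]) (Φ ω) := by
  have hm : mγ.comap (fun ω ↦ G (Φ ω)) ≤ m0 := (hG.comp hΦ).comap_le
  have hint : Integrable (fun ω ↦ ((μ.map Φ)[F | mγ.comap G]) (Φ ω)) μ :=
    (integrable_condExp (μ := μ.map Φ)).comp_measurable hΦ
  refine (ae_eq_condExp_of_forall_setIntegral_eq hm (hF.comp_measurable hΦ)
    (fun s _ _ ↦ hint.integrableOn) ?_ ?_).symm
  · rintro s ⟨t, ht, rfl⟩ -
    have h := setIntegral_condExp hG.comap_le hF (s := G ⁻¹' t) ⟨t, ht, rfl⟩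
    rw [setIntegral_map (hG ht) integrable_condExp.aestronglyMeasurable hΦ.aemeasurable,
      setIntegral_map (hG ht) hF.aestronglyMeasurable hΦ.aemeasurable] at h
    exact h
  · refine StronglyMeasurable.aestronglyMeasurable ?_
    refine (stronglyMeasurable_condExp (m := mγ.comap G)).comp_measurable ?_
    rintro _ ⟨t, ht, rfl⟩
    exact ⟨t, ht, rfl⟩

lemma condCovGiven_comp_of_map {β γ : Type*} [MeasurableSpace β] [mγ : MeasurableSpace γ]
    [IsFiniteMeasure μ] {p : ℕ} {Φ : Ω → β} (hΦ : Measurable Φ) {F : β → Fin p → ℝ} {G : β → γ}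
    (hG : Measurable G) (hF : ∀ i, Integrable (fun b ↦ F b i) (μ.map Φ)) :
    condCovGiven μ (fun ω ↦ F (Φ ω)) (mγ.comap (fun ω ↦ G (Φ ω))) =
      condCovGiven (μ.map Φ) F (mγ.comap G) := by
  ext i j
  have hae (i) := (hF i).aestronglyMeasurable.sub
    (integrable_condExp (m := mγ.comap G) (f := fun b ↦ F b i) (μ := μ.map Φ)).aestronglyMeasurable
  simp only [condCovGiven, Matrix.of_apply]
  refine Eq.trans (integral_congr_ae ?_)
    (integral_map hΦ.aemeasurable ((hae i).mul (hae j))).symm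
  filter_upwards [condExp_comp_of_map hΦ hG (hF i), condExp_comp_of_map hΦ hG (hF j)]
    with ω hi hj
  simp [hi, hj]

lemma integral_sq_sub_condExp [IsProbabilityMeasure μ] (hm : m ≤ m0)
    {f : Ω → ℝ} (hf : MemLp f 2 μ) :
    ∫ ω, (f ω - (μ[f | m]) ω) ^ 2 ∂μ = ∫ ω, f ω ^ 2 ∂μ - ∫ ω, (μ[f | m]) ω ^ 2 ∂μ := by
  have h := integral_condVar_add_variance_condExp hm hf
  have h₁ : ∫ ω, (Var[f; μ | m]) ω ∂μ = ∫ ω, (f ω - (μ[f | m]) ω) ^ 2 ∂μ := by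
    rw [condVar, integral_condExp hm]; rfl
  rw [variance_eq_sub hf, variance_eq_sub (hf.condExp one_le_two), integral_condExp hm, h₁] at h
  simp only [Pi.pow_apply] at h
  linarith

lemma integral_sq_condExp_le [IsProbabilityMeasure μ] (hm : m ≤ m0)
    {f : Ω → ℝ} (hf : MemLp f 2 μ) :
    ∫ ω, (μ[f | m]) ω ^ 2 ∂μ ≤ ∫ ω, f ω ^ 2 ∂μ := by
  have h := integral_sq_sub_condExp hm hf
  have h₁ : 0 ≤ ∫ ω, (f ω - (μ[f | m]) ω) ^ 2 ∂μ := integral_nonneg fun ω ↦ sq_nonneg _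
  linarith

/-- Tower property through an independent enlargement of the conditioning σ-algebra. -/
lemma condExp_condExp_of_le_sup_indep [IsProbabilityMeasure μ]
    (hV : mV ≤ m0) (hZ : mZ ≤ m0) (h₁V : m₁ ≤ mV) (h₂ : m₂ ≤ m₁ ⊔ mZ) (hind : Indep mV mZ μ)
    {f : Ω → ℝ} (hf : Integrable f μ) (hfV : StronglyMeasurable[mV] f) :
    μ[μ[f | m₁] | m₂] =ᵐ[μ] μ[f | m₂] := by
  have h₁ : m₁ ≤ m0 := h₁V.trans hV
  have hsup : m₁ ⊔ mZ ≤ m0 := sup_le h₁ hZ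
  set D : Ω → ℝ := f - μ[f | m₁] with hD
  have hDint : Integrable D μ := hf.sub integrable_condExp
  have hDV : StronglyMeasurable[mV] D := hfV.sub (stronglyMeasurable_condExp.mono h₁V)
  have hDs (s : Set Ω) (hs : MeasurableSet[m₁] s) : ∫ ω in s, D ω ∂μ = 0 := by
    simp only [hD, Pi.sub_apply]
    rw [integral_sub hf.integrableOn integrable_condExp.integrableOn,
      setIntegral_condExp h₁ hf hs, sub_self]
  have hDD : ∫ ω, D ω ∂μ = 0 := by simpa using hDs Set.univ MeasurableSet.univ
  have hpi (s t : Set Ω) (hs : MeasurableSet[m₁] s) (ht : MeasurableSet[mZ] t) :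
      ∫ ω in s ∩ t, D ω ∂μ = 0 := by
    have hc : μ[s.indicator D | mZ] =ᵐ[μ] fun _ ↦ ∫ ω, s.indicator D ω ∂μ :=
      condExp_indep_eq hV hZ (hDV.indicator (h₁V _ hs)) hind
    rw [integral_indicator (h₁ _ hs), hDs s hs] at hc
    rw [Set.inter_comm, ← setIntegral_indicator (h₁ _ hs),
      ← setIntegral_condExp hZ (hDint.indicator (h₁ _ hs)) ht,
      setIntegral_congr_ae (hZ _ ht) (hc.mono fun ω h _ ↦ h)]
    simp
  have hgen : m₁ ⊔ mZ = MeasurableSpace.generateFrom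
      {u | ∃ s t, MeasurableSet[m₁] s ∧ MeasurableSet[mZ] t ∧ s ∩ t = u} := by
    refine le_antisymm (sup_le ?_ ?_) (MeasurableSpace.generateFrom_le ?_)
    · exact fun s hs ↦ MeasurableSpace.measurableSet_generateFrom
        ⟨s, Set.univ, hs, MeasurableSet.univ, Set.inter_univ s⟩
    · exact fun t ht ↦ MeasurableSpace.measurableSet_generateFrom
        ⟨Set.univ, t, MeasurableSet.univ, ht, Set.univ_inter t⟩
    · rintro _ ⟨s, t, hs, ht, rfl⟩
      exact MeasurableSet.inter (le_sup_left (a := m₁) (b := mZ) s hs)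
        (le_sup_right (a := m₁) (b := mZ) t ht)
  have hpis : IsPiSystem {u | ∃ s t, MeasurableSet[m₁] s ∧ MeasurableSet[mZ] t ∧ s ∩ t = u} := by
    rintro _ ⟨s, t, hs, ht, rfl⟩ _ ⟨s', t', hs', ht', rfl⟩ -
    exact ⟨s ∩ s', t ∩ t', hs.inter hs', ht.inter ht', Set.inter_inter_inter_comm s s' t t'⟩
  have hall (u : Set Ω) (hu : MeasurableSet[m₁ ⊔ mZ] u) : ∫ ω in u, D ω ∂μ = 0 := by
    induction u, hu using MeasurableSpace.induction_on_inter (m := m₁ ⊔ mZ) hgen hpis with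
    | empty => simp
    | basic u hu =>
      obtain ⟨s, t, hs, ht, rfl⟩ := hu
      exact hpi s t hs ht
    | compl u hu h => rw [setIntegral_compl (hsup _ hu) hDint, h, hDD, sub_zero]
    | iUnion g hd hg h =>
      rw [integral_iUnion (fun i ↦ hsup _ (hg i)) hd hDint.integrableOn]
      simp [h]
  refine ae_eq_condExp_of_forall_setIntegral_eq (h₂.trans hsup) hf
    (fun _ _ _ ↦ integrable_condExp.integrableOn) (fun s hs _ ↦ ?_)
    stronglyMeasurable_condExp.aestronglyMeasurable
  rw [setIntegral_condExp (h₂.trans hsup) integrable_condExp hs]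
  have := hall s (h₂ s hs)
  simp only [hD, Pi.sub_apply] at this
  rw [integral_sub hf.integrableOn integrable_condExp.integrableOn] at this
  linarith

end CondExp

section RandomVector

open Matrix

variable {Ω : Type*} {m : MeasurableSpace Ω} [m0 : MeasurableSpace Ω] {μ : Measure Ω} {p : ℕ}

lemma memLp_dotProduct {X : Ω → Fin p → ℝ} (hX : ∀ i, MemLp (fun ω ↦ X ω i) 2 μ)
    (u : Fin p → ℝ) : MemLp (fun ω ↦ u ⬝ᵥ X ω) 2 μ :=
  memLp_finsetSum _ fun i _ ↦ (hX i).const_mul (u i)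

lemma integral_dotProduct_eq_zero [IsFiniteMeasure μ] {X : Ω → Fin p → ℝ}
    (hX : ∀ i, MemLp (fun ω ↦ X ω i) 2 μ) (h0 : ∀ i, ∫ ω, X ω i ∂μ = 0) (u : Fin p → ℝ) :
    ∫ ω, u ⬝ᵥ X ω ∂μ = 0 := by
  simp only [dotProduct]
  rw [integral_finsetSum _ fun i _ ↦ ((hX i).integrable one_le_two).const_mul (u i)]
  simp [integral_const_mul, h0]

lemma integral_dotProduct_mul_dotProduct {R : Ω → Fin p → ℝ}
    (hR : ∀ i, MemLp (fun ω ↦ R ω i) 2 μ) (u v : Fin p → ℝ) :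
    ∫ ω, (u ⬝ᵥ R ω) * (v ⬝ᵥ R ω) ∂μ = u ⬝ᵥ (of fun i j ↦ ∫ ω, R ω i * R ω j ∂μ) *ᵥ v := by
  have hint (i j) : Integrable (fun ω ↦ u i * R ω i * (v j * R ω j)) μ :=
    ((hR i).const_mul (u i)).integrable_mul ((hR j).const_mul (v j))
  simp only [dotProduct, mulVec, of_apply, Finset.sum_mul_sum]
  rw [integral_finsetSum _ fun i _ ↦ integrable_finsetSum _ fun j _ ↦ hint i j]
  refine Finset.sum_congr rfl fun i _ ↦ ?_
  rw [integral_finsetSum _ fun j _ ↦ hint i j, Finset.mul_sum]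
  refine Finset.sum_congr rfl fun j _ ↦ ?_
  rw [← integral_mul_const, ← integral_const_mul]
  congr with ω
  ring

lemma integral_dotProduct_mul_dotProduct_eq_crossCov {R : Ω → Fin p → ℝ}
    (hR : ∀ i, MemLp (fun ω ↦ R ω i) 2 μ) (h0 : ∀ i, ∫ ω, R ω i ∂μ = 0) (u v : Fin p → ℝ) :
    ∫ ω, (u ⬝ᵥ R ω) * (v ⬝ᵥ R ω) ∂μ = u ⬝ᵥ crossCov μ R R *ᵥ v := by
  rw [integral_dotProduct_mul_dotProduct hR]
  simp [crossCov, h0]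

lemma condExp_dotProduct [IsFiniteMeasure μ] {X : Ω → Fin p → ℝ}
    (hX : ∀ i, MemLp (fun ω ↦ X ω i) 2 μ) (u : Fin p → ℝ) :
    μ[fun ω ↦ u ⬝ᵥ X ω | m] =ᵐ[μ] fun ω ↦ u ⬝ᵥ fun i ↦ (μ[fun ω' ↦ X ω' i | m]) ω := by
  have h₁ : (fun ω ↦ u ⬝ᵥ X ω) = ∑ i, u i • fun ω ↦ X ω i := by
    ext ω; simp [dotProduct]
  have h₂ : ∀ᵐ ω ∂μ, ∀ i, (μ[u i • fun ω' ↦ X ω' i | m]) ω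
      = u i * (μ[fun ω' ↦ X ω' i | m]) ω :=
    ae_all_iff.2 fun i ↦ condExp_smul (u i) (fun ω' ↦ X ω' i) m
  rw [h₁]
  filter_upwards [condExp_finsetSum (s := Finset.univ) (f := fun i ↦ u i • fun ω ↦ X ω i)
    (fun i _ ↦ ((hX i).integrable one_le_two).smul (u i)) m, h₂] with ω h₃ h₄
  rw [h₃, Finset.sum_apply]
  exact Finset.sum_congr rfl fun i _ ↦ h₄ i

lemma dotProduct_condCovGiven_mulVec [IsFiniteMeasure μ] {X : Ω → Fin p → ℝ}
    (hX : ∀ i, MemLp (fun ω ↦ X ω i) 2 μ) (u : Fin p → ℝ) :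
    u ⬝ᵥ condCovGiven μ X m *ᵥ u
      = ∫ ω, (u ⬝ᵥ X ω - (μ[fun ω' ↦ u ⬝ᵥ X ω' | m]) ω) ^ 2 ∂μ := by
  have h := integral_dotProduct_mul_dotProduct
    (R := fun ω i ↦ X ω i - (μ[fun ω' ↦ X ω' i | m]) ω)
    (fun i ↦ (hX i).sub ((hX i).condExp one_le_two)) u u
  rw [condCovGiven, ← h]
  refine integral_congr_ae ?_
  filter_upwards [condExp_dotProduct (m := m) hX u] with ω hω
  rw [hω, ← dotProduct_sub, sq]
  rfl

lemma posSemidef_condCovGiven [IsFiniteMeasure μ] {X : Ω → Fin p → ℝ}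
    (hX : ∀ i, MemLp (fun ω ↦ X ω i) 2 μ) : (condCovGiven μ X m).PosSemidef := by
  refine PosSemidef.of_dotProduct_mulVec_nonneg ?_ fun u ↦ ?_
  · ext i j
    simp [condCovGiven, mul_comm]
  · rw [star_trivial, dotProduct_condCovGiven_mulVec hX]
    exact integral_nonneg fun ω ↦ sq_nonneg _

/-- When `X + N` is observed, the estimation errors of `X` and of the noise `N` agree up to sign. -/
lemma dotProduct_crossCov_sub_condCovGiven_mulVec [IsProbabilityMeasure μ]
    {X N : Ω → Fin p → ℝ} (hm : m ≤ m0) (hX : ∀ i, MemLp (fun ω ↦ X ω i) 2 μ)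
    (hN : ∀ i, MemLp (fun ω ↦ N ω i) 2 μ) (h0 : ∀ i, ∫ ω, N ω i ∂μ = 0)
    (hXN : Measurable[m] fun ω ↦ X ω + N ω) (u : Fin p → ℝ) :
    u ⬝ᵥ (crossCov μ N N - condCovGiven μ X m) *ᵥ u
      = ∫ ω, (μ[fun ω' ↦ u ⬝ᵥ N ω' | m]) ω ^ 2 ∂μ := by
  have hu := memLp_dotProduct hN u
  have hux := memLp_dotProduct hX u
  have hmeas : StronglyMeasurable[m] fun ω ↦ u ⬝ᵥ (X ω + N ω) := by
    refine Measurable.stronglyMeasurable ?_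
    exact (by fun_prop : Measurable fun x : Fin p → ℝ ↦ u ⬝ᵥ x).comp hXN
  have hadd : (fun ω ↦ u ⬝ᵥ (X ω + N ω)) = (fun ω ↦ u ⬝ᵥ X ω) + fun ω ↦ u ⬝ᵥ N ω := by
    ext ω; simp [dotProduct_add]
  have hce : μ[fun ω ↦ u ⬝ᵥ (X ω + N ω) | m] = fun ω ↦ u ⬝ᵥ (X ω + N ω) := by
    refine condExp_of_stronglyMeasurable hm hmeas ?_
    rw [hadd]
    exact (hux.add hu).integrable one_le_two
  have hsum := condExp_add (hux.integrable one_le_two) (hu.integrable one_le_two) m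
  rw [← hadd, hce] at hsum
  have herr : ∫ ω, (u ⬝ᵥ X ω - (μ[fun ω' ↦ u ⬝ᵥ X ω' | m]) ω) ^ 2 ∂μ
      = ∫ ω, (u ⬝ᵥ N ω - (μ[fun ω' ↦ u ⬝ᵥ N ω' | m]) ω) ^ 2 ∂μ := by
    refine integral_congr_ae ?_
    filter_upwards [hsum] with ω hω
    simp only [dotProduct_add, Pi.add_apply] at hω
    rw [← sq_abs, ← sq_abs (u ⬝ᵥ N ω - _), ← abs_neg]
    congr 2
    linarith
  rw [sub_mulVec, dotProduct_sub, dotProduct_condCovGiven_mulVec hX,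
    ← integral_dotProduct_mul_dotProduct_eq_crossCov hN h0, herr, integral_sq_sub_condExp hm hu]
  simp only [← sq]
  ring

end RandomVector

section Gaussian

open Matrix

variable {Ω : Type*} [MeasurableSpace Ω] {μ : Measure Ω} {p : ℕ}

lemma exists_forall_eq_dotProduct (L : StrongDual ℝ (Fin p → ℝ)) :
    ∃ u : Fin p → ℝ, ∀ x, L x = u ⬝ᵥ x := by
  refine ⟨fun i ↦ L (Pi.single i 1), fun x ↦ ?_⟩
  conv_lhs => rw [pi_eq_sum_univ' x]
  simp [dotProduct, mul_comm]

lemma IsGaussianVec.hasGaussianLaw {X : Ω → Fin p → ℝ} (hX : Measurable X)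
    (h : IsGaussianVec μ X) : HasGaussianLaw X μ := by
  refine ⟨isGaussian_of_map_eq_gaussianReal fun L ↦ ?_⟩
  obtain ⟨u, hu⟩ := exists_forall_eq_dotProduct L
  obtain ⟨c, v, hcv⟩ := h u
  refine ⟨c, v, ?_⟩
  rw [Measure.map_map (by fun_prop) hX, ← hcv]
  congr 1
  ext ω
  simp [hu, dotProduct]

lemma ProbabilityTheory.HasGaussianLaw.memLp_two_eval {X : Ω → Fin p → ℝ}
    (hX : HasGaussianLaw X μ) (i : Fin p) :
    MemLp (fun ω ↦ X ω i) 2 μ :=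
  (HasGaussianLaw.eval (X := fun i ω ↦ X ω i) hX i).memLp_two

lemma map_eq_map_of_crossCov_eq {Ω' : Type*} [MeasurableSpace Ω'] {μ' : Measure Ω'}
    {X : Ω → Fin p → ℝ} {Y : Ω' → Fin p → ℝ} (hX : HasGaussianLaw X μ) (hY : HasGaussianLaw Y μ')
    (hX0 : ∀ i, ∫ ω, X ω i ∂μ = 0) (hY0 : ∀ i, ∫ ω, Y ω i ∂μ' = 0)
    (h : crossCov μ X X = crossCov μ' Y Y) : μ.map X = μ'.map Y := by
  have := hX.isProbabilityMeasure
  have := hY.isProbabilityMeasure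
  refine Measure.ext_of_charFunDual (funext fun L ↦ ?_)
  rw [hX.charFunDual_map_eq, hY.charFunDual_map_eq]
  obtain ⟨u, hu⟩ := exists_forall_eq_dotProduct L
  have hLX : L ∘ X = fun ω ↦ u ⬝ᵥ X ω := funext fun ω ↦ hu _
  have hLY : L ∘ Y = fun ω ↦ u ⬝ᵥ Y ω := funext fun ω ↦ hu _
  have hmX := integral_dotProduct_eq_zero hX.memLp_two_eval hX0 u
  have hmY := integral_dotProduct_eq_zero hY.memLp_two_eval hY0 u
  rw [hLX, hLY,
    variance_of_integral_eq_zero (memLp_dotProduct hX.memLp_two_eval u).aemeasurable hmX,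
    variance_of_integral_eq_zero (memLp_dotProduct hY.memLp_two_eval u).aemeasurable hmY, hmX, hmY]
  simp only [sq]
  rw [integral_dotProduct_mul_dotProduct_eq_crossCov hX.memLp_two_eval hX0,
    integral_dotProduct_mul_dotProduct_eq_crossCov hY.memLp_two_eval hY0, h]

lemma exists_hasGaussianLaw_crossCov_eq {T : Matrix (Fin p) (Fin p) ℝ} (hT : T.PosSemidef) :
    ∃ (ν : Measure (EuclideanSpace ℝ (Fin p))) (Z : EuclideanSpace ℝ (Fin p) → Fin p → ℝ),
      IsProbabilityMeasure ν ∧ Measurable Z ∧ HasGaussianLaw Z ν ∧ (∀ i, ∫ x, Z x i ∂ν = 0) ∧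
      crossCov ν Z Z = T := by
  refine ⟨multivariateGaussian 0 T, WithLp.ofLp, inferInstance, by fun_prop, ?_, fun i ↦ ?_, ?_⟩
  · exact IsGaussian.hasGaussianLaw_id.map
      (EuclideanSpace.equiv (Fin p) ℝ).toContinuousLinearMap
  · have h := (EuclideanSpace.proj (𝕜 := ℝ) i).integral_comp_comm
      (IsGaussian.integrable_fun_id (μ := multivariateGaussian 0 T))
    simpa using h
  · ext i j
    exact covariance_eval_multivariateGaussian hT i j

lemma ProbabilityTheory.IndepFun.prodMk_right_of_prodMk_left {β γ δ : Type*} [MeasurableSpace β]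
    [MeasurableSpace γ] [MeasurableSpace δ] [IsProbabilityMeasure μ] {A : Ω → β} {B : Ω → γ}
    {C : Ω → δ} (hA : Measurable A) (hB : Measurable B) (hC : Measurable C)
    (hAB : IndepFun A B μ) (hABC : IndepFun (fun ω ↦ (A ω, B ω)) C μ) :
    IndepFun A (fun ω ↦ (B ω, C ω)) μ := by
  have hBC : IndepFun B C μ := hABC.comp measurable_snd measurable_id
  have e := (indepFun_iff_map_prod_eq_prod_map_map (by fun_prop) (by fun_prop)).1 hABC
  rw [indepFun_iff_map_prod_eq_prod_map_map (by fun_prop) (by fun_prop)] at hAB hBC ⊢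
  have h : (fun ω ↦ (A ω, (B ω, C ω))) = MeasurableEquiv.prodAssoc ∘ fun ω ↦ ((A ω, B ω), C ω) :=
    rfl
  have := Measure.isProbabilityMeasure_map (μ := μ) hA.aemeasurable
  have := Measure.isProbabilityMeasure_map (μ := μ) hB.aemeasurable
  have := Measure.isProbabilityMeasure_map (μ := μ) hC.aemeasurable
  rw [h, ← Measure.map_map (by fun_prop) (by fun_prop), e, hAB, Measure.prodAssoc_prod, hBC]


lemma integral_dotProduct_mul_dotProduct_of_indepFun [IsProbabilityMeasure μ]
    {N Z : Ω → Fin p → ℝ} (hN : ∀ i, MemLp (fun ω ↦ N ω i) 2 μ)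
    (hZ : ∀ i, MemLp (fun ω ↦ Z ω i) 2 μ) (hZ0 : ∀ i, ∫ ω, Z ω i ∂μ = 0)
    (hNZ : IndepFun N Z μ) (u v : Fin p → ℝ) : ∫ ω, (u ⬝ᵥ N ω) * (v ⬝ᵥ Z ω) ∂μ = 0 := by
  have h : IndepFun (fun ω ↦ u ⬝ᵥ N ω) (fun ω ↦ v ⬝ᵥ Z ω) μ :=
    hNZ.comp (φ := fun x ↦ u ⬝ᵥ x) (ψ := fun x ↦ v ⬝ᵥ x) (by fun_prop) (by fun_prop)
  rw [h.integral_fun_mul_eq_mul_integral (memLp_dotProduct hN u).aestronglyMeasurable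
    (memLp_dotProduct hZ v).aestronglyMeasurable, integral_dotProduct_eq_zero hZ hZ0 v, mul_zero]

lemma integral_dotProduct_add_mul_dotProduct_add [IsProbabilityMeasure μ]
    {N Z : Ω → Fin p → ℝ} (hN : ∀ i, MemLp (fun ω ↦ N ω i) 2 μ)
    (hZ : ∀ i, MemLp (fun ω ↦ Z ω i) 2 μ) (hN0 : ∀ i, ∫ ω, N ω i ∂μ = 0)
    (hZ0 : ∀ i, ∫ ω, Z ω i ∂μ = 0) (hNZ : IndepFun N Z μ) (a b c d : Fin p → ℝ) :
    ∫ ω, (a ⬝ᵥ N ω + b ⬝ᵥ Z ω) * (c ⬝ᵥ N ω + d ⬝ᵥ Z ω) ∂μ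
      = a ⬝ᵥ crossCov μ N N *ᵥ c + b ⬝ᵥ crossCov μ Z Z *ᵥ d := by
  have i₁ : Integrable (fun ω ↦ (a ⬝ᵥ N ω) * (c ⬝ᵥ N ω)) μ :=
    (memLp_dotProduct hN a).integrable_mul (memLp_dotProduct hN c)
  have i₂ : Integrable (fun ω ↦ (a ⬝ᵥ N ω) * (d ⬝ᵥ Z ω)) μ :=
    (memLp_dotProduct hN a).integrable_mul (memLp_dotProduct hZ d)
  have i₃ : Integrable (fun ω ↦ (b ⬝ᵥ Z ω) * (c ⬝ᵥ N ω)) μ :=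
    (memLp_dotProduct hZ b).integrable_mul (memLp_dotProduct hN c)
  have i₄ : Integrable (fun ω ↦ (b ⬝ᵥ Z ω) * (d ⬝ᵥ Z ω)) μ :=
    (memLp_dotProduct hZ b).integrable_mul (memLp_dotProduct hZ d)
  have e : (fun ω ↦ (a ⬝ᵥ N ω + b ⬝ᵥ Z ω) * (c ⬝ᵥ N ω + d ⬝ᵥ Z ω))
      = fun ω ↦ ((a ⬝ᵥ N ω) * (c ⬝ᵥ N ω) + (a ⬝ᵥ N ω) * (d ⬝ᵥ Z ω))
        + ((b ⬝ᵥ Z ω) * (c ⬝ᵥ N ω) + (b ⬝ᵥ Z ω) * (d ⬝ᵥ Z ω)) := by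
    ext ω; ring
  rw [e, integral_add (by exact i₁.add i₂) (by exact i₃.add i₄), integral_add i₁ i₂,
    integral_add i₃ i₄,
    integral_dotProduct_mul_dotProduct_eq_crossCov hN hN0,
    integral_dotProduct_mul_dotProduct_eq_crossCov hZ hZ0,
    integral_dotProduct_mul_dotProduct_of_indepFun hN hZ hZ0 hNZ,
    integral_dotProduct_mul_dotProduct_of_indepFun hZ hN hN0 hNZ.symm]
  ring

lemma crossCov_add_of_indepFun [IsProbabilityMeasure μ]
    {N Z : Ω → Fin p → ℝ} (hN : ∀ i, MemLp (fun ω ↦ N ω i) 2 μ)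
    (hZ : ∀ i, MemLp (fun ω ↦ Z ω i) 2 μ) (hN0 : ∀ i, ∫ ω, N ω i ∂μ = 0)
    (hZ0 : ∀ i, ∫ ω, Z ω i ∂μ = 0) (hNZ : IndepFun N Z μ) :
    crossCov μ (fun ω ↦ N ω + Z ω) (fun ω ↦ N ω + Z ω) = crossCov μ N N + crossCov μ Z Z := by
  ext i j
  have hmean (i) : ∫ ω, (N ω i + Z ω i) ∂μ = 0 := by
    rw [integral_add ((hN i).integrable one_le_two) ((hZ i).integrable one_le_two), hN0, hZ0,
      add_zero]
  have h := integral_dotProduct_add_mul_dotProduct_add hN hZ hN0 hZ0 hNZ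
    (Pi.single i 1) (Pi.single i 1) (Pi.single j 1) (Pi.single j 1)
  simp only [single_dotProduct, one_mul, mulVec_single_one, col_apply] at h
  simpa only [crossCov, of_apply, hmean, sub_zero, Pi.add_apply, Matrix.add_apply] using h

/-- A linear combination of two independent centred Gaussian vectors which is uncorrelated with
their sum is independent of it, jointly with any data independent of the pair. -/
lemma indepFun_dotProduct_add_of_mulVec_eq_zero {β : Type*} [MeasurableSpace β]
    [IsProbabilityMeasure μ] {N Z : Ω → Fin p → ℝ} {V : Ω → β} (hNm : Measurable N)
    (hZm : Measurable Z) (hV : Measurable V) (hN : HasGaussianLaw N μ) (hZ : HasGaussianLaw Z μ)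
    (hN0 : ∀ i, ∫ ω, N ω i ∂μ = 0) (hZ0 : ∀ i, ∫ ω, Z ω i ∂μ = 0) (hNZ : IndepFun N Z μ)
    (hNZV : IndepFun (fun ω ↦ (N ω, Z ω)) V μ) {a b : Fin p → ℝ}
    (hab : a ᵥ* crossCov μ N N + b ᵥ* crossCov μ Z Z = 0) :
    IndepFun (fun ω ↦ a ⬝ᵥ N ω + b ⬝ᵥ Z ω) (fun ω ↦ (N ω + Z ω, V ω)) μ := by
  have hlin : Continuous fun x : (Fin p → ℝ) × (Fin p → ℝ) ↦ (a ⬝ᵥ x.1 + b ⬝ᵥ x.2, x.1 + x.2) := by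
    fun_prop
  let L : (Fin p → ℝ) × (Fin p → ℝ) →L[ℝ] ℝ × (Fin p → ℝ) :=
    { toFun := fun x ↦ (a ⬝ᵥ x.1 + b ⬝ᵥ x.2, x.1 + x.2)
      map_add' := fun x y ↦ by
        ext
        · simp [dotProduct_add]; ring
        · simp; ring
      map_smul' := fun c x ↦ by
        ext
        · simp [dotProduct_smul, mul_add]
        · simp [mul_add]
      cont := hlin }
  have hgauss : HasGaussianLaw (fun ω ↦ (a ⬝ᵥ N ω + b ⬝ᵥ Z ω, N ω + Z ω)) μ :=
    (hNZ.hasGaussianLaw hN hZ).map_fun L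
  refine IndepFun.prodMk_right_of_prodMk_left (by fun_prop) (by fun_prop) hV
    (hgauss.indepFun_of_covariance_strongDual fun L₁ L₂ ↦ ?_) ?_
  · obtain ⟨u, hu⟩ := exists_forall_eq_dotProduct L₂
    have hNi := hN.memLp_two_eval
    have hZi := hZ.memLp_two_eval
    have hm₁ := (memLp_dotProduct hNi a).add (memLp_dotProduct hZi b)
    have hm₂ := (memLp_dotProduct hNi u).add (memLp_dotProduct hZi u)
    have h₁ : L₁ ∘ (fun ω ↦ a ⬝ᵥ N ω + b ⬝ᵥ Z ω)
        = fun ω ↦ L₁ 1 * (a ⬝ᵥ N ω + b ⬝ᵥ Z ω) := by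
      ext ω
      have := L₁.map_smul (a ⬝ᵥ N ω + b ⬝ᵥ Z ω) (1 : ℝ)
      simp only [smul_eq_mul, mul_one] at this
      simp only [Function.comp_apply, this, mul_comm]
    have h₂ : L₂ ∘ (fun ω ↦ N ω + Z ω) = fun ω ↦ u ⬝ᵥ N ω + u ⬝ᵥ Z ω := by
      ext ω; simp only [Function.comp_apply, hu, dotProduct_add]
    have hmean : ∫ ω, (u ⬝ᵥ N ω + u ⬝ᵥ Z ω) ∂μ = 0 := by
      rw [integral_add ((memLp_dotProduct hNi u).integrable one_le_two)
        ((memLp_dotProduct hZi u).integrable one_le_two), integral_dotProduct_eq_zero hNi hN0,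
        integral_dotProduct_eq_zero hZi hZ0, add_zero]
    have hcov : ∫ ω, (a ⬝ᵥ N ω + b ⬝ᵥ Z ω) * (u ⬝ᵥ N ω + u ⬝ᵥ Z ω) ∂μ = 0 := by
      rw [integral_dotProduct_add_mul_dotProduct_add hNi hZi hN0 hZ0 hNZ, dotProduct_mulVec,
        dotProduct_mulVec, ← add_dotProduct, hab, zero_dotProduct]
    rw [h₁, h₂, covariance_const_mul_left]
    refine mul_eq_zero_of_right _ ?_
    refine (covariance_eq_sub hm₁ hm₂).trans ?_
    simp only [Pi.mul_apply, Pi.add_apply]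
    rw [hcov, hmean, mul_zero, sub_zero]
  · exact hNZV.comp (φ := fun x ↦ (a ⬝ᵥ x.1 + b ⬝ᵥ x.2, x.1 + x.2)) hlin.measurable measurable_id

end Gaussian

section FisherInformation

open Matrix

variable {Ω : Type*} {m₁ m₂ : MeasurableSpace Ω} [m0 : MeasurableSpace Ω] {μ : Measure Ω} {p : ℕ}

/-- Conditional Fisher information inequality for the noise `N + Z`, in terms of MMSE error
covariances. -/
lemma dotProduct_crossCov_sub_condCovGiven_le {α : Type*} [mα : MeasurableSpace α]
    [IsProbabilityMeasure μ] {X N Z : Ω → Fin p → ℝ} {U : Ω → α} (hXm : Measurable X)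
    (hNm : Measurable N) (hZm : Measurable Z) (hU : Measurable U)
    (hX : ∀ i, MemLp (fun ω ↦ X ω i) 2 μ) (hN : HasGaussianLaw N μ) (hZ : HasGaussianLaw Z μ)
    (hN0 : ∀ i, ∫ ω, N ω i ∂μ = 0) (hZ0 : ∀ i, ∫ ω, Z ω i ∂μ = 0)
    (hind : IndepFun N (fun ω ↦ (X ω, U ω)) μ)
    (hindZ : IndepFun Z (fun ω ↦ (N ω, (X ω, U ω))) μ)
    (hm₁ : m₁ = MeasurableSpace.comap (fun ω ↦ (X ω + N ω, U ω)) inferInstance)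
    (hm₂ : m₂ = MeasurableSpace.comap (fun ω ↦ (X ω + (N ω + Z ω), U ω)) inferInstance)
    {s t w : Fin p → ℝ}
    (hstw : w ᵥ* (crossCov μ N N + crossCov μ Z Z) = s ᵥ* crossCov μ N N + t ᵥ* crossCov μ Z Z) :
    w ⬝ᵥ (crossCov μ (fun ω ↦ N ω + Z ω) (fun ω ↦ N ω + Z ω)
        - condCovGiven μ X m₂) *ᵥ w
      ≤ s ⬝ᵥ (crossCov μ N N - condCovGiven μ X m₁) *ᵥ s + t ⬝ᵥ crossCov μ Z Z *ᵥ t := by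
  have hNi := hN.memLp_two_eval
  have hZi := hZ.memLp_two_eval
  have hNZi (i) : MemLp (fun ω ↦ (N ω + Z ω) i) 2 μ := (hNi i).add (hZi i)
  have hNZ : IndepFun N Z μ := (hindZ.comp measurable_id measurable_fst).symm
  have hNZ0 (i) : ∫ ω, (N ω + Z ω) i ∂μ = 0 := by
    simp only [Pi.add_apply]
    rw [integral_add ((hNi i).integrable one_le_two) ((hZi i).integrable one_le_two), hN0, hZ0,
      add_zero]
  have hVm : Measurable fun ω ↦ (X ω, U ω) := by fun_prop
  have hNZV : IndepFun (fun ω ↦ (N ω, Z ω)) (fun ω ↦ (X ω, U ω)) μ := by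
    have h := IndepFun.prodMk_right_of_prodMk_left hVm hNm hZm hind.symm
      (hindZ.symm.comp measurable_swap measurable_id)
    exact h.symm
  have hg₁ : Measurable fun ω ↦ (X ω + N ω, U ω) := by fun_prop
  have hg₂ : Measurable fun ω ↦ (X ω + (N ω + Z ω), U ω) := by fun_prop
  have hle₁ : m₁ ≤ m0 := hm₁ ▸ hg₁.comap_le
  have hle₂ : m₂ ≤ m0 := hm₂ ▸ hg₂.comap_le
  have hc₁ : Measurable[m₁] fun ω ↦ (X ω + N ω, U ω) := hm₁ ▸ comap_measurable _
  have hc₂ : Measurable[m₂] fun ω ↦ (X ω + (N ω + Z ω), U ω) := hm₂ ▸ comap_measurable _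
  rw [dotProduct_crossCov_sub_condCovGiven_mulVec hle₂ hX hNZi hNZ0
      (measurable_fst.comp hc₂) w,
    dotProduct_crossCov_sub_condCovGiven_mulVec hle₁ hX hNi hN0
      (measurable_fst.comp hc₁) s]
  have hs := memLp_dotProduct hNi s
  have ht := memLp_dotProduct hZi t
  have hw := memLp_dotProduct hNZi w
  have hq := hs.condExp one_le_two (m := m₁)
  have hV : Measurable fun ω ↦ (N ω, (X ω, U ω)) := by fun_prop
  have hindV : Indep (MeasurableSpace.comap (fun ω ↦ (N ω, (X ω, U ω))) inferInstance)
      (MeasurableSpace.comap Z inferInstance) μ := hindZ.symm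
  have h₁V : m₁ ≤ MeasurableSpace.comap (fun ω ↦ (N ω, (X ω, U ω))) inferInstance := by
    have : Measurable fun x : (Fin p → ℝ) × ((Fin p → ℝ) × α) ↦ (x.2.1 + x.1, x.2.2) := by fun_prop
    exact hm₁ ▸ (this.comp (comap_measurable fun ω ↦ (N ω, (X ω, U ω)))).comap_le
  have htower : μ[μ[fun ω ↦ s ⬝ᵥ N ω | m₁] | m₂] =ᵐ[μ] μ[fun ω ↦ s ⬝ᵥ N ω | m₂] := by
    refine condExp_condExp_of_le_sup_indep hV.comap_le hZm.comap_le h₁V ?_ hindV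
      (hs.integrable one_le_two) ?_
    · have h₁ : Measurable[m₁ ⊔ MeasurableSpace.comap Z inferInstance]
          fun ω ↦ (X ω + N ω, U ω) := hc₁.mono le_sup_left le_rfl
      have h₂ : Measurable[m₁ ⊔ MeasurableSpace.comap Z inferInstance] Z :=
        (comap_measurable _).mono le_sup_right le_rfl
      have : Measurable fun x : ((Fin p → ℝ) × α) × (Fin p → ℝ) ↦ (x.1.1 + x.2, x.1.2) := by
        fun_prop
      have h := (this.comp (h₁.prodMk h₂)).comap_le
      rw [hm₂]
      simpa only [Function.comp_def, add_assoc] using h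
    · refine Measurable.stronglyMeasurable ?_
      exact (by fun_prop : Measurable fun x : (Fin p → ℝ) × ((Fin p → ℝ) × α) ↦ s ⬝ᵥ x.1).comp
        (comap_measurable _)
  have hr : μ[fun ω ↦ (s - w) ⬝ᵥ N ω + (t - w) ⬝ᵥ Z ω | m₂] =ᵐ[μ] 0 := by
    have hI := indepFun_dotProduct_add_of_mulVec_eq_zero hNm hZm hVm hN hZ hN0 hZ0 hNZ hNZV
      (a := s - w) (b := t - w) (by
        rw [sub_vecMul, sub_vecMul, sub_add_sub_comm, ← hstw, ← vecMul_add, sub_self])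
    have hrm : Measurable fun ω ↦ (s - w) ⬝ᵥ N ω + (t - w) ⬝ᵥ Z ω := by fun_prop
    have hI' : Indep (MeasurableSpace.comap (fun ω ↦ (s - w) ⬝ᵥ N ω + (t - w) ⬝ᵥ Z ω)
        inferInstance) m₂ μ := by
      refine indep_of_indep_of_le_right hI ?_
      have : Measurable fun x : (Fin p → ℝ) × ((Fin p → ℝ) × α) ↦ (x.2.1 + x.1, x.2.2) := by
        fun_prop
      exact hm₂ ▸ (this.comp (comap_measurable fun ω ↦ (N ω + Z ω, (X ω, U ω)))).comap_le
    have h := condExp_indep_eq hrm.comap_le hle₂ (comap_measurable _).stronglyMeasurable hI'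
    rw [integral_add ((memLp_dotProduct hNi _).integrable one_le_two)
      ((memLp_dotProduct hZi _).integrable one_le_two), integral_dotProduct_eq_zero hNi hN0,
      integral_dotProduct_eq_zero hZi hZ0, add_zero] at h
    exact h
  have hproj : μ[μ[fun ω ↦ s ⬝ᵥ N ω | m₁] + fun ω ↦ t ⬝ᵥ Z ω | m₂]
      =ᵐ[μ] μ[fun ω ↦ w ⬝ᵥ (N ω + Z ω) | m₂] := by
    have hsplit : (fun ω ↦ s ⬝ᵥ N ω) + (fun ω ↦ t ⬝ᵥ Z ω)
        = (fun ω ↦ w ⬝ᵥ (N ω + Z ω)) + fun ω ↦ (s - w) ⬝ᵥ N ω + (t - w) ⬝ᵥ Z ω := by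
      ext ω
      simp only [Pi.add_apply, dotProduct_add, sub_dotProduct]
      ring
    have h₁ := condExp_add (hq.integrable one_le_two) (ht.integrable one_le_two) m₂
    have h₂ := condExp_add (hs.integrable one_le_two) (ht.integrable one_le_two) m₂
    have h₃ := condExp_add (hw.integrable one_le_two)
      (((memLp_dotProduct hNi (s - w)).add (memLp_dotProduct hZi (t - w))).integrable one_le_two) m₂
    rw [hsplit] at h₂
    filter_upwards [h₁, h₂, h₃, htower, hr] with ω e₁ e₂ e₃ e₄ e₅
    have e₆ := e₂.symm.trans e₃
    have e₅' : (μ[(fun ω ↦ (s - w) ⬝ᵥ N ω) + fun ω ↦ (t - w) ⬝ᵥ Z ω | m₂]) ω = 0 := e₅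
    simp only [Pi.add_apply] at e₁ e₆
    rw [e₅'] at e₆
    rw [e₁, e₄, e₆, add_zero]
  have hcross : ∫ ω, (μ[fun ω' ↦ s ⬝ᵥ N ω' | m₁]) ω * (t ⬝ᵥ Z ω) ∂μ = 0 := by
    have hI : IndepFun (μ[fun ω' ↦ s ⬝ᵥ N ω' | m₁]) (fun ω ↦ t ⬝ᵥ Z ω) μ := by
      refine indep_of_indep_of_le_left (indep_of_indep_of_le_right hindV ?_) ?_
      · exact ((by fun_prop : Measurable fun x : Fin p → ℝ ↦ t ⬝ᵥ x).comp
          (comap_measurable Z)).comap_le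
      · exact (stronglyMeasurable_condExp.mono h₁V).measurable.comap_le
    rw [hI.integral_fun_mul_eq_mul_integral hq.aestronglyMeasurable ht.aestronglyMeasurable,
      integral_dotProduct_eq_zero hZi hZ0, mul_zero]
  calc ∫ ω, (μ[fun ω' ↦ w ⬝ᵥ (N ω' + Z ω') | m₂]) ω ^ 2 ∂μ
      = ∫ ω, (μ[μ[fun ω ↦ s ⬝ᵥ N ω | m₁] + fun ω ↦ t ⬝ᵥ Z ω | m₂]) ω ^ 2 ∂μ :=
        integral_congr_ae (hproj.mono fun ω h ↦ by simp only [h])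
    _ ≤ ∫ ω, (μ[fun ω ↦ s ⬝ᵥ N ω | m₁] + fun ω ↦ t ⬝ᵥ Z ω) ω ^ 2 ∂μ :=
        integral_sq_condExp_le hle₂ (hq.add ht)
    _ = ∫ ω, ((μ[fun ω ↦ s ⬝ᵥ N ω | m₁]) ω ^ 2
          + (2 * ((μ[fun ω' ↦ s ⬝ᵥ N ω' | m₁]) ω * (t ⬝ᵥ Z ω)) + (t ⬝ᵥ Z ω) * (t ⬝ᵥ Z ω))) ∂μ := by
        congr with ω
        simp only [Pi.add_apply]
        ring
    _ = _ := by
        have i₂ : Integrable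
            (fun ω ↦ 2 * ((μ[fun ω' ↦ s ⬝ᵥ N ω' | m₁]) ω * (t ⬝ᵥ Z ω))) μ :=
          (hq.integrable_mul ht).const_mul 2
        have i₃ : Integrable (fun ω ↦ (t ⬝ᵥ Z ω) * (t ⬝ᵥ Z ω)) μ := ht.integrable_mul ht
        rw [integral_add hq.integrable_sq (by exact i₂.add i₃), integral_add i₂ i₃, integral_const_mul,
          hcross, integral_dotProduct_mul_dotProduct_eq_crossCov hZi hZ0]
        ring

end FisherInformation

section Transfer

variable {Ω Ω' α : Type*} [MeasurableSpace Ω] [MeasurableSpace Ω'] [MeasurableSpace α]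
  {μ : Measure Ω} {μ' : Measure Ω'} {p : ℕ}

/-- The error covariance of `X` given `(X + N, U)` only depends on the laws of `N` and `(X, U)`. -/
lemma condCovGiven_eq_of_map_eq [IsProbabilityMeasure μ] [IsProbabilityMeasure μ']
    {X N : Ω → Fin p → ℝ} {U : Ω → α} {X' N' : Ω' → Fin p → ℝ} {U' : Ω' → α}
    (hX : Measurable X) (hN : Measurable N) (hU : Measurable U)
    (hX' : Measurable X') (hN' : Measurable N') (hU' : Measurable U')
    (hXi : ∀ i, Integrable (fun ω ↦ X ω i) μ)
    (hind : IndepFun N (fun ω ↦ (X ω, U ω)) μ) (hind' : IndepFun N' (fun ω ↦ (X' ω, U' ω)) μ')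
    (hNN : μ.map N = μ'.map N')
    (hXU : μ.map (fun ω ↦ (X ω, U ω)) = μ'.map fun ω ↦ (X' ω, U' ω)) :
    condCovGiven μ X (MeasurableSpace.comap (fun ω ↦ (X ω + N ω, U ω)) inferInstance)
      = condCovGiven μ' X'
        (MeasurableSpace.comap (fun ω ↦ (X' ω + N' ω, U' ω)) inferInstance) := by
  have hG : Measurable fun b : (Fin p → ℝ) × ((Fin p → ℝ) × α) ↦ (b.2.1 + b.1, b.2.2) := by
    fun_prop
  have hlaw : μ.map (fun ω ↦ (N ω, (X ω, U ω))) = μ'.map fun ω ↦ (N' ω, (X' ω, U' ω)) := by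
    rw [(indepFun_iff_map_prod_eq_prod_map_map (by fun_prop) (by fun_prop)).1 hind,
      (indepFun_iff_map_prod_eq_prod_map_map (by fun_prop) (by fun_prop)).1 hind', hNN, hXU]
  have hΦ : Measurable fun ω ↦ (N ω, (X ω, U ω)) := by fun_prop
  have hΦ' : Measurable fun ω ↦ (N' ω, (X' ω, U' ω)) := by fun_prop
  have hF (i) : Integrable (fun b : (Fin p → ℝ) × ((Fin p → ℝ) × α) ↦ b.2.1 i)
      (μ.map fun ω ↦ (N ω, (X ω, U ω))) :=
    (integrable_map_measure
      (by fun_prop : Measurable fun b : (Fin p → ℝ) × ((Fin p → ℝ) × α) ↦ b.2.1 i).aestronglyMeasurable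
      hΦ.aemeasurable).2 (hXi i)
  have h := condCovGiven_comp_of_map hΦ (F := fun b ↦ b.2.1) hG hF
  have h' := condCovGiven_comp_of_map hΦ' (F := fun b ↦ b.2.1) hG (hlaw ▸ hF)
  rw [hlaw] at h
  exact h.trans h'.symm

lemma MeasureTheory.MeasurePreserving.integral_fun_comp {f : Ω' → Ω}
    (hf : MeasurePreserving f μ' μ) {g : Ω → ℝ} (hg : Measurable g) :
    ∫ ω, g (f ω) ∂μ' = ∫ ω, g ω ∂μ := by
  rw [← hf.map_eq, integral_map hf.aemeasurable hg.aestronglyMeasurable]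

lemma MeasureTheory.MeasurePreserving.crossCov_comp {f : Ω' → Ω}
    (hf : MeasurePreserving f μ' μ) {N : Ω → Fin p → ℝ} (hN : Measurable N) :
    crossCov μ' (fun ω ↦ N (f ω)) (fun ω ↦ N (f ω)) = crossCov μ N N := by
  ext i j
  simp only [crossCov, Matrix.of_apply]
  have hNi (i) : Measurable fun ω ↦ N ω i := by fun_prop
  rw [hf.integral_fun_comp (hNi i), hf.integral_fun_comp (hNi j)]
  exact hf.integral_fun_comp (g := fun ω ↦ (N ω i - ∫ ω', N ω' i ∂μ) * (N ω j - ∫ ω', N ω' j ∂μ))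
    (by fun_prop)

lemma MeasureTheory.MeasurePreserving.hasGaussianLaw_comp {f : Ω' → Ω}
    (hf : MeasurePreserving f μ' μ) {N : Ω → Fin p → ℝ} (hNm : Measurable N)
    (hN : HasGaussianLaw N μ) : HasGaussianLaw (fun ω ↦ N (f ω)) μ' := by
  refine ⟨?_⟩
  have h := Measure.map_map (μ := μ') hNm hf.measurable
  rw [hf.map_eq] at h
  exact h ▸ hN.isGaussian_map

end Transfer

/-- MMSE ordering lemma: for Gaussian `X`, arbitrary `U`, and independent Gaussian noises
`N₁ ~ N(0,Σ₁)`, `N₂ ~ N(0,Σ₂)` with `Σ₂ ≻ Σ₁ ≻ 0`,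
`Cov(X|X+N₁,U)⁻¹ − Σ₁⁻¹ ⪰ Cov(X|X+N₂,U)⁻¹ − Σ₂⁻¹`. -/
theorem stmt9 {Ω : Type*} [MeasurableSpace Ω] (μ : Measure Ω) [IsProbabilityMeasure μ]
    {p : ℕ} {α : Type*} [MeasurableSpace α]
    (X N1 N2 : Ω → Fin p → ℝ) (U : Ω → α)
    (hX : Measurable X) (hN1 : Measurable N1) (hN2 : Measurable N2) (hU : Measurable U)
    (hXgauss : IsGaussianVec μ X)
    (S1 S2 : Matrix (Fin p) (Fin p) ℝ) (hS1 : S1.PosDef) (hS21 : (S2 - S1).PosDef)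
    (hN1gauss : IsGaussianVec μ N1) (hN1mean : ∀ i, (∫ ω, N1 ω i ∂μ) = 0)
    (hN1cov : crossCov μ N1 N1 = S1)
    (hN2gauss : IsGaussianVec μ N2) (hN2mean : ∀ i, (∫ ω, N2 ω i ∂μ) = 0)
    (hN2cov : crossCov μ N2 N2 = S2)
    (hind1 : IndepFun N1 (fun ω => (X ω, U ω)) μ)
    (hind2 : IndepFun N2 (fun ω => (X ω, U ω)) μ)
    -- the MMSE error covariance matrices are assumed invertible
    (hinv1 : IsUnit (condCovGiven μ X
      (MeasurableSpace.comap (fun ω => (X ω + N1 ω, U ω)) inferInstance)).det)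
    (hinv2 : IsUnit (condCovGiven μ X
      (MeasurableSpace.comap (fun ω => (X ω + N2 ω, U ω)) inferInstance)).det) :
    (((condCovGiven μ X
          (MeasurableSpace.comap (fun ω => (X ω + N1 ω, U ω)) inferInstance))⁻¹ - S1⁻¹) -
      ((condCovGiven μ X
          (MeasurableSpace.comap (fun ω => (X ω + N2 ω, U ω)) inferInstance))⁻¹ - S2⁻¹)).PosSemidef := by
  obtain ⟨ν, Z, hν, hZm, hZ, hZ0, hZcov⟩ := exists_hasGaussianLaw_crossCov_eq hS21.posSemidef
  have hN1g := hN1gauss.hasGaussianLaw hN1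
  have hN2g := hN2gauss.hasGaussianLaw hN2
  have hX2 := (hXgauss.hasGaussianLaw hX).memLp_two_eval
  have hXi (i) := (hX2 i).integrable one_le_two
  have hfst : MeasurePreserving Prod.fst (μ.prod ν) μ := measurePreserving_fst
  have hsnd : MeasurePreserving Prod.snd (μ.prod ν) ν := measurePreserving_snd
  have hN := hfst.hasGaussianLaw_comp hN1 hN1g
  have hZ' := hsnd.hasGaussianLaw_comp hZm hZ
  have hN0 (i) : ∫ x, N1 x.1 i ∂μ.prod ν = 0 :=
    (hfst.integral_fun_comp (g := fun ω ↦ N1 ω i) (by fun_prop)).trans (hN1mean i)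
  have hZ0' (i) : ∫ x, Z x.2 i ∂μ.prod ν = 0 :=
    (hsnd.integral_fun_comp (g := fun ω ↦ Z ω i) (by fun_prop)).trans (hZ0 i)
  have hNcov := (hfst.crossCov_comp hN1).trans hN1cov
  have hZcov' := (hsnd.crossCov_comp hZm).trans hZcov
  have hXU : μ.map (fun ω ↦ (X ω, U ω)) = (μ.prod ν).map fun x ↦ (X x.1, U x.1) := by
    nth_rw 1 [← hfst.map_eq]
    rw [Measure.map_map (by fun_prop) measurable_fst, Function.comp_def]
  have hind : IndepFun (fun x ↦ N1 x.1) (fun x ↦ (X x.1, U x.1)) (μ.prod ν) := by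
    rw [indepFun_iff_map_prod_eq_prod_map_map (by fun_prop) (by fun_prop)] at hind1 ⊢
    rw [← hXU]
    have e₁ := Measure.map_map (μ := μ.prod ν) hN1 measurable_fst
    have e₂ := Measure.map_map (μ := μ.prod ν) (hN1.prodMk (hX.prodMk hU)) measurable_fst
    rw [hfst.map_eq, Function.comp_def] at e₁ e₂
    rw [← e₁, ← e₂, hind1]
  have hindZ : IndepFun (fun x ↦ Z x.2) (fun x ↦ (N1 x.1, (X x.1, U x.1))) (μ.prod ν) :=
    (indepFun_prod (X := fun ω ↦ (N1 ω, (X ω, U ω))) (Y := Z) (by fun_prop) hZm).symm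
  have hNZ : IndepFun (fun x ↦ N1 x.1) (fun x ↦ Z x.2) (μ.prod ν) :=
    (hindZ.comp measurable_id measurable_fst).symm
  have hindNZ : IndepFun (fun x ↦ N1 x.1 + Z x.2) (fun x ↦ (X x.1, U x.1)) (μ.prod ν) := by
    have h := IndepFun.prodMk_right_of_prodMk_left (A := fun x : Ω × _ ↦ (X x.1, U x.1))
      (B := fun x ↦ N1 x.1) (C := fun x ↦ Z x.2) (by fun_prop) (by fun_prop) (by fun_prop) hind.symm
      (hindZ.symm.comp measurable_swap measurable_id)
    exact (h.comp measurable_id (measurable_fst.add measurable_snd)).symm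
  have hNZ0 (i) : ∫ x, (N1 x.1 + Z x.2) i ∂μ.prod ν = 0 := by
    simp only [Pi.add_apply]
    rw [integral_add ((hN.memLp_two_eval i).integrable one_le_two)
      ((hZ'.memLp_two_eval i).integrable one_le_two), hN0, hZ0', add_zero]
  have hNZcov : crossCov (μ.prod ν) (fun x ↦ N1 x.1 + Z x.2) (fun x ↦ N1 x.1 + Z x.2) = S2 := by
    rw [crossCov_add_of_indepFun hN.memLp_two_eval hZ'.memLp_two_eval hN0 hZ0' hNZ, hNcov, hZcov',
      add_sub_cancel]
  have hN1map : μ.map N1 = (μ.prod ν).map fun x ↦ N1 x.1 :=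
    map_eq_map_of_crossCov_eq hN1g hN hN1mean hN0 (hN1cov.trans hNcov.symm)
  have hN2map : μ.map N2 = (μ.prod ν).map fun x ↦ N1 x.1 + Z x.2 :=
    map_eq_map_of_crossCov_eq hN2g (hNZ.hasGaussianLaw hN hZ').fun_add hN2mean hNZ0
      (hN2cov.trans hNZcov.symm)
  have hM1 := condCovGiven_eq_of_map_eq hX hN1 hU (hX.comp measurable_fst)
    (hN1.comp measurable_fst) (hU.comp measurable_fst) hXi hind1 hind hN1map hXU
  have hM2 := condCovGiven_eq_of_map_eq (N' := fun x ↦ N1 x.1 + Z x.2) hX hN2 hU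
    (hX.comp measurable_fst) (by fun_prop) (hU.comp measurable_fst) hXi hind2 hindNZ hN2map hXU
  have hpos1 := (posSemidef_condCovGiven hX2).posDef_iff_isUnit.2
    ((Matrix.isUnit_iff_isUnit_det _).2 hinv1)
  have hpos2 := (posSemidef_condCovGiven hX2).posDef_iff_isUnit.2
    ((Matrix.isUnit_iff_isUnit_det _).2 hinv2)
  have hS2 : S2.PosDef := by simpa using hS1.add hS21
  have hg1 : Measurable fun ω ↦ (X ω + N1 ω, U ω) := by fun_prop
  refine posSemidef_inv_sub_inv_sub hpos1 hpos2 hS1 hS2 ?_ fun s t w hstw ↦ ?_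
  · refine Matrix.PosSemidef.of_dotProduct_mulVec_nonneg (hS1.1.sub hpos1.1) fun u ↦ ?_
    rw [star_trivial, ← hN1cov, dotProduct_crossCov_sub_condCovGiven_mulVec hg1.comap_le hX2
      hN1g.memLp_two_eval hN1mean (measurable_fst.comp (comap_measurable _))]
    exact integral_nonneg fun ω ↦ sq_nonneg _
  · have hX2' (i) : MemLp (fun x : Ω × EuclideanSpace ℝ (Fin p) ↦ X x.1 i) 2 (μ.prod ν) :=
      (hX2 i).comp_measurePreserving hfst
    have hsymm {A : Matrix (Fin p) (Fin p) ℝ} (hA : A.IsHermitian) (v : Fin p → ℝ) :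
        Matrix.vecMul v A = Matrix.mulVec A v := by
      rw [← Matrix.mulVec_transpose, ← Matrix.conjTranspose_eq_transpose_of_trivial, hA.eq]
    have h := dotProduct_crossCov_sub_condCovGiven_le (μ := μ.prod ν) (X := fun x ↦ X x.1)
      (N := fun x ↦ N1 x.1) (Z := fun x ↦ Z x.2) (U := fun x ↦ U x.1) (hX.comp measurable_fst)
      (hN1.comp measurable_fst) (hZm.comp measurable_snd) (hU.comp measurable_fst) hX2' hN hZ'
      hN0 hZ0' hind hindZ rfl rfl (s := s) (t := t) (w := w) (by
        rw [hNcov, hZcov', add_sub_cancel, hsymm hS2.1, hsymm hS1.1, hsymm hS21.1, hstw])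
    rw [hNZcov, hNcov, hZcov'] at h
    rw [hM1, hM2]
    exact h
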